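/- arXiv:1509.06985 — 4 statements merged into one kernel-verified Lean document; each statement's English description precedes it below -/
import Mathlib

section
/- If two configurations x and x' have the same degree sequence, i.e. d_i(x) = d_i(x') for all i = 1, …, n, then P_u(X = x) = P_u(X = x'). In other words, conditional on the degree sequence, the generalized random graph is uniformly distributed over all simple graphs with that degree sequence. -/
open Finset

lemma prob_factor (n : ℕ) (u : Fin n → ℝ) (x : Fin n → Fin n → Bool)
    (hsym : ∀ i j, x i j = x j i) (hdiag : ∀ i, x i i = false) :
    (∏ p ∈ Finset.univ.filter (fun p : Fin n × Fin n => p.1 < p.2),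
      ((u p.1 * u p.2 / (1 + u p.1 * u p.2)) ^ (if x p.1 p.2 then 1 else 0) *
        (1 / (1 + u p.1 * u p.2)) ^ (if x p.1 p.2 then 0 else 1)))
    = (∏ p ∈ Finset.univ.filter (fun p : Fin n × Fin n => p.1 < p.2),
        (1 / (1 + u p.1 * u p.2))) * ∏ i, u i ^ (∑ j, if x i j then (1:ℕ) else 0) := by
  have h1 : ∏ i, u i ^ (∑ j, if x i j then (1:ℕ) else 0)
      = (∏ i, ∏ j, if i < j then u i ^ (if x i j then 1 else 0) else 1) *
        ∏ i, ∏ j, if i < j then u j ^ (if x i j then 1 else 0) else 1 := by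
    rw [Finset.prod_comm (f := fun i j => if i < j then u j ^ (if x i j then 1 else 0) else 1),
      ← Finset.prod_mul_distrib]
    refine Finset.prod_congr rfl fun i _ => ?_
    rw [← Finset.prod_pow_eq_pow_sum, ← Finset.prod_mul_distrib]
    refine Finset.prod_congr rfl fun j _ => ?_
    rcases lt_trichotomy i j with h | h | h
    · simp [h, h.not_gt]
    · subst h; simp [hdiag]
    · simp [h, h.not_gt, hsym i j]
  rw [h1, Finset.prod_filter, Finset.prod_filter, Fintype.prod_prod_type,
    Fintype.prod_prod_type]
  simp only [← Finset.prod_mul_distrib]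
  refine Finset.prod_congr rfl fun i _ => Finset.prod_congr rfl fun j _ => ?_
  by_cases h : i < j
  · cases hx : x i j
    · simp [h]
    · simp [h]; ring
  · simp [h]

/-- In the generalized random graph, two configurations with the same
degree sequence have the same probability: if `d_i(x) = d_i(x')` for all `i`, then
`P_u(X = x) = P_u(X = x')`. Hence, conditionally on the degree sequence, the graph is
uniform over all simple graphs with that degree sequence. -/
theorem prob_eq_of_degree_seq_eq (n : ℕ) (u : Fin n → ℝ) (hu : ∀ i, 0 ≤ u i)
    (x x' : Fin n → Fin n → Bool)
    (hsym : ∀ i j, x i j = x j i) (hdiag : ∀ i, x i i = false)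
    (hsym' : ∀ i j, x' i j = x' j i) (hdiag' : ∀ i, x' i i = false)
    (hdeg : ∀ i, (∑ j, if x i j then 1 else 0) = ∑ j, if x' i j then (1:ℕ) else 0) :
    (∏ p ∈ Finset.univ.filter (fun p : Fin n × Fin n => p.1 < p.2),
      ((u p.1 * u p.2 / (1 + u p.1 * u p.2)) ^ (if x p.1 p.2 then 1 else 0) *
        (1 / (1 + u p.1 * u p.2)) ^ (if x p.1 p.2 then 0 else 1)))
    = ∏ p ∈ Finset.univ.filter (fun p : Fin n × Fin n => p.1 < p.2),
      ((u p.1 * u p.2 / (1 + u p.1 * u p.2)) ^ (if x' p.1 p.2 then 1 else 0) *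
        (1 / (1 + u p.1 * u p.2)) ^ (if x' p.1 p.2 then 0 else 1)) := by
  rw [prob_factor n u x hsym hdiag, prob_factor n u x' hsym' hdiag']
  simp only [hdeg]
end

section
/- Fix w > 0 and t ∈ [0,1], and let φ(x) = (1 + xwt)/(1 + xw), so φ'(x) = w(t−1)/(1+xw)^2. Then lim_{n→∞} n ∫_0^∞ φ'(x) (1 − V(n^{1/α} x)) dx = c ∫_0^∞ φ'(x) x^{-α} dx = (t − 1) w^{α} γ, where γ = c ∫_0^∞ (1+x)^{-2} x^{-α} dx. -/
open MeasureTheory Filter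

lemma aux_integrable (α w : ℝ) (hα : α ∈ Set.Ioo (0:ℝ) 1) (hw : 0 < w) :
    IntegrableOn (fun x : ℝ => ((1 + x * w) ^ 2)⁻¹ * x ^ (-α)) (Set.Ioi 0) := by
  obtain ⟨h0, h1⟩ := hα
  have hm : Measurable (fun x : ℝ => ((1 + x * w) ^ 2)⁻¹ * x ^ (-α)) := by fun_prop
  rw [← Set.Ioc_union_Ioi_eq_Ioi (zero_le_one (α := ℝ))]
  refine IntegrableOn.union ?_ ?_
  · have hi : IntegrableOn (fun x : ℝ => x ^ (-α)) (Set.Ioc 0 1) := by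
      have := intervalIntegral.intervalIntegrable_rpow' (a := 0) (b := 1) (r := -α) (by linarith)
      rwa [intervalIntegrable_iff_integrableOn_Ioc_of_le zero_le_one] at this
    refine Integrable.mono' hi hm.aestronglyMeasurable ?_
    refine (ae_restrict_iff' measurableSet_Ioc).2 (Eventually.of_forall fun x hx => ?_)
    have hx0 : 0 < x := hx.1
    have hp : 0 ≤ x ^ (-α) := by positivity
    rw [Real.norm_of_nonneg (by positivity)]
    have hxw : 0 < x * w := by positivity
    have : ((1 + x * w) ^ 2)⁻¹ ≤ 1 := inv_le_one_of_one_le₀ (by nlinarith)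
    nlinarith
  · have hi : IntegrableOn (fun x : ℝ => (w ^ 2)⁻¹ * x ^ (-2 : ℝ)) (Set.Ioi 1) :=
      (integrableOn_Ioi_rpow_of_lt (by norm_num) zero_lt_one).const_mul _
    refine Integrable.mono' hi hm.aestronglyMeasurable ?_
    refine (ae_restrict_iff' measurableSet_Ioi).2 (Eventually.of_forall fun x hx => ?_)
    have hx1 : 1 < x := hx
    have hx0 : 0 < x := by linarith
    rw [Real.norm_of_nonneg (by positivity)]
    have hp : x ^ (-α) ≤ 1 := Real.rpow_le_one_of_one_le_of_nonpos hx1.le (by linarith)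
    have e : x ^ (-2 : ℝ) = (x ^ 2)⁻¹ := by
      rw [Real.rpow_neg hx0.le]; norm_num
    have hxw : 0 < x * w := by positivity
    have : ((1 + x * w) ^ 2)⁻¹ ≤ (w ^ 2)⁻¹ * (x ^ 2)⁻¹ := by
      rw [← mul_inv]
      apply inv_anti₀ (by positivity)
      nlinarith
    rw [e]
    calc _ ≤ ((1 + x * w) ^ 2)⁻¹ * 1 := by gcongr
      _ ≤ _ := by simpa using this

lemma key (α : ℝ) (h0 : 0 < α) (V : ℝ → ℝ) (n : ℝ) (hn : 0 < n) (x : ℝ) (hx : 0 < x) :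
    n * (1 - V (n ^ α⁻¹ * x)) =
      x ^ (-α) * ((n ^ α⁻¹ * x) ^ α * (1 - V (n ^ α⁻¹ * x))) := by
  have hxp : x ^ α * x ^ (-α) = 1 := by rw [← Real.rpow_add hx]; simp
  have e : (n ^ α⁻¹ * x) ^ α = n * x ^ α := by
    rw [Real.mul_rpow (by positivity) hx.le, ← Real.rpow_mul hn.le, inv_mul_cancel₀ h0.ne',
      Real.rpow_one]
  rw [e]
  linear_combination (-(n * (1 - V (n ^ α⁻¹ * x)))) * hxp

/-- Let `V` be the cdf of a nonnegative random variable with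
`y^α (1 - V y)` bounded on `(0,∞)` and converging to `c > 0` as `y → ∞`, where
`α ∈ (0,1)`. Fix `w > 0`, `t ∈ [0,1]` and let `φ(x) = (1 + xwt)/(1 + xw)`, so that
`φ'(x) = w(t-1)/(1+xw)^2`. Then
`n ∫_0^∞ φ'(x) (1 - V(n^{1/α} x)) dx → c ∫_0^∞ φ'(x) x^{-α} dx = (t-1) w^α γ`,
with `γ = c ∫_0^∞ (1+x)^{-2} x^{-α} dx`. -/
theorem tail_integral_tendsto (α c : ℝ) (hα : α ∈ Set.Ioo (0:ℝ) 1) (hc : 0 < c)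
    (V : ℝ → ℝ) (hVmono : Monotone V) (hV0 : ∀ y, 0 ≤ V y) (hV1 : ∀ y, V y ≤ 1)
    (hVneg : ∀ y < 0, V y = 0)
    (hbdd : ∃ M, ∀ y > (0:ℝ), y ^ α * (1 - V y) ≤ M)
    (htail : Tendsto (fun y : ℝ => y ^ α * (1 - V y)) atTop (nhds c))
    (w t : ℝ) (hw : 0 < w) (ht : t ∈ Set.Icc (0:ℝ) 1) :
    Tendsto (fun n : ℕ => (n : ℝ) * ∫ x in Set.Ioi (0:ℝ),
        (w * (t - 1) / (1 + x * w) ^ 2) * (1 - V ((n : ℝ) ^ α⁻¹ * x)))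
      atTop
      (nhds (c * ∫ x in Set.Ioi (0:ℝ), (w * (t - 1) / (1 + x * w) ^ 2) * x ^ (-α)))
    ∧ c * ∫ x in Set.Ioi (0:ℝ), (w * (t - 1) / (1 + x * w) ^ 2) * x ^ (-α)
      = (t - 1) * w ^ α * (c * ∫ x in Set.Ioi (0:ℝ), ((1 + x) ^ 2)⁻¹ * x ^ (-α)) := by
  have hint := aux_integrable α w hα hw
  obtain ⟨h0, h1⟩ := hα
  obtain ⟨M, hM⟩ := hbdd
  constructor
  · simp_rw [← integral_const_mul]
    refine tendsto_integral_of_dominated_convergence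
      (fun x => |w * (t - 1)| * M * (((1 + x * w) ^ 2)⁻¹ * x ^ (-α))) ?_
      (hint.const_mul _) ?_ ?_
    · intro n
      have := hVmono.measurable
      exact Measurable.aestronglyMeasurable (by fun_prop)
    · intro n
      refine (ae_restrict_iff' measurableSet_Ioi).2 (Eventually.of_forall fun x hx => ?_)
      have hx0 : 0 < x := hx
      have hM0 : 0 ≤ M := le_trans (mul_nonneg (by positivity) (by linarith [hV1 1])) (hM 1 one_pos)
      rcases Nat.eq_zero_or_pos n with rfl | hn
      · simp only [Nat.cast_zero, zero_mul, norm_zero]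
        positivity
      have hn' : (0 : ℝ) < n := by exact_mod_cast hn
      have hk := key α h0 V n hn' x hx0
      have hy : 0 < (n : ℝ) ^ α⁻¹ * x := by positivity
      have hb := hM _ hy
      have hnn : 0 ≤ ((n : ℝ) ^ α⁻¹ * x) ^ α * (1 - V ((n : ℝ) ^ α⁻¹ * x)) :=
        mul_nonneg (by positivity) (by linarith [hV1 ((n : ℝ) ^ α⁻¹ * x)])
      rw [mul_left_comm, hk, norm_mul, norm_div, Real.norm_eq_abs (w * (t - 1)),
        Real.norm_of_nonneg (by positivity : 0 ≤ (1 + x * w) ^ 2),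
        Real.norm_of_nonneg (mul_nonneg (by positivity) hnn), div_eq_mul_inv]
      calc _ ≤ |w * (t - 1)| * ((1 + x * w) ^ 2)⁻¹ * (x ^ (-α) * M) := by gcongr
        _ = _ := by ring
    · refine (ae_restrict_iff' measurableSet_Ioi).2 (Eventually.of_forall fun x hx => ?_)
      have hx0 : 0 < x := hx
      have hT : Tendsto (fun n : ℕ => (n : ℝ) ^ α⁻¹ * x) atTop atTop :=
        ((tendsto_rpow_atTop (inv_pos.2 h0)).comp tendsto_natCast_atTop_atTop).atTop_mul_const hx0
      have hl := (htail.comp hT).const_mul ((w * (t - 1) / (1 + x * w) ^ 2) * x ^ (-α))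
      rw [mul_comm c]
      refine hl.congr' ?_
      filter_upwards [eventually_gt_atTop 0] with n hn
      have hn' : (0 : ℝ) < n := by exact_mod_cast hn
      have hk := key α h0 V n hn' x hx0
      rw [mul_left_comm (n : ℝ), hk, Function.comp, mul_assoc]
  · have hs := integral_comp_mul_right_Ioi (fun x : ℝ => ((1 + x) ^ 2)⁻¹ * x ^ (-α)) 0 hw
    rw [zero_mul, smul_eq_mul] at hs
    have e : ∫ x in Set.Ioi (0:ℝ), (w * (t - 1) / (1 + x * w) ^ 2) * x ^ (-α)
        = (w * (t - 1) * w ^ α) *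
          ∫ x in Set.Ioi (0:ℝ), ((1 + x * w) ^ 2)⁻¹ * (x * w) ^ (-α) := by
      rw [← integral_const_mul]
      refine setIntegral_congr_fun measurableSet_Ioi fun x hx => ?_
      have hx0 : 0 < x := hx
      have hwp : w ^ α * w ^ (-α) = 1 := by rw [← Real.rpow_add hw]; simp
      rw [Real.mul_rpow hx0.le hw.le, div_eq_mul_inv]
      linear_combination (-(w * (t - 1) * ((1 + x * w) ^ 2)⁻¹ * x ^ (-α))) * hwp
    rw [e, hs]
    field_simp
end

section
/- For every t ∈ [0,1], lim_{n→∞} (1 + μ_n (t−1)/(n−1))^{n−1} · E[ ((n−1)/(n − 1 + μ_n (t−1)))^{Y_n} ] = e^{μ(t−1)}. (The left-hand side equals the probability generating function E[t^{Z_k}] of the number Z_k of incoming edges at a fixed vertex, from vertices not hit by its outgoing edges, in the directed random graph G_dir(n,G); hence Z_k converges in distribution to a Poisson distribution with mean μ.) -/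
open Filter Finset

lemma aux_split (f : ℕ → ℝ) (hf : Summable f) (N : ℕ) :
    ∑ k ∈ Finset.range N, f k + ∑' j : ℕ, (if N ≤ j then f j else 0) = ∑' j, f j := by
  have h1 : Summable (fun j : ℕ => if N ≤ j then f j else 0) := by
    have := hf.indicator {j : ℕ | N ≤ j}
    refine this.congr ?_
    intro j
    simp [Set.indicator]
  rw [← hf.sum_add_tsum_nat_add N, ← h1.sum_add_tsum_nat_add N]
  have h2 : ∑ k ∈ Finset.range N, (if N ≤ k then f k else 0) = 0 := by
    apply Finset.sum_eq_zero
    intro k hk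
    rw [if_neg (by simpa using hk)]
  rw [h2]
  simp

lemma aux_bound (p : ℕ → ℝ) (hp : ∀ k, 0 ≤ p k) (N : ℕ) (A : ℝ) (hA : 0 < A) (hA1 : A ≤ 1)
    (h1 : ∑ k ∈ Finset.range (N+1), p k = 1) :
    A ^ N ≤ A ^ N * ∑ k ∈ Finset.range (N+1), p k * (A⁻¹) ^ k ∧
    A ^ N * ∑ k ∈ Finset.range (N+1), p k * (A⁻¹) ^ k ≤
      A ^ N + (∑ k ∈ Finset.range (N+1), (k:ℝ) * p k) * (1 - A) := by
  have key : ∀ k ∈ Finset.range (N+1), A ^ N * (A⁻¹) ^ k = A ^ (N - k) := by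
    intro k hk
    have hk' : k ≤ N := by simpa [Nat.lt_succ_iff] using hk
    rw [pow_sub₀ A hA.ne' hk', inv_pow]
  have e : A ^ N * ∑ k ∈ Finset.range (N+1), p k * (A⁻¹) ^ k
      = ∑ k ∈ Finset.range (N+1), p k * A ^ (N - k) := by
    rw [Finset.mul_sum]
    refine Finset.sum_congr rfl fun k hk => ?_
    rw [← key k hk]; ring
  have e2 : A ^ N = ∑ k ∈ Finset.range (N+1), p k * A ^ N := by
    rw [← Finset.sum_mul, h1, one_mul]
  rw [e]
  constructor
  · conv_lhs => rw [e2]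
    refine Finset.sum_le_sum fun k hk => ?_
    exact mul_le_mul_of_nonneg_left (pow_le_pow_of_le_one hA.le hA1 (Nat.sub_le _ _)) (hp k)
  · conv_rhs => rw [e2]
    rw [Finset.sum_mul, ← Finset.sum_add_distrib]
    refine Finset.sum_le_sum fun k hk => ?_
    have hk' : k ≤ N := by simpa [Nat.lt_succ_iff] using hk
    have hb : 1 - (k:ℝ) * (1 - A) ≤ A ^ k := by
      have := one_add_mul_le_pow (a := A - 1) (by linarith) k
      calc _ = 1 + (k:ℝ) * (A - 1) := by ring
        _ ≤ _ := this
        _ = _ := by ring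
    have hN : A ^ N = A ^ (N - k) * A ^ k := by rw [← pow_add, Nat.sub_add_cancel hk']
    have h3 : A ^ (N - k) ≤ 1 := pow_le_one₀ hA.le hA1
    have h4 : 0 ≤ A ^ (N - k) := pow_nonneg hA.le _
    have h5 : 0 ≤ (k:ℝ) * (1 - A) := mul_nonneg (Nat.cast_nonneg _) (by linarith)
    have h6 : A ^ (N - k) ≤ A ^ N + (k:ℝ) * (1 - A) := by
      rw [hN]; nlinarith
    nlinarith [hp k, mul_le_mul_of_nonneg_left h6 (hp k)]

/-- Let `G = {g k}` be a probability distribution on ℕ with finite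
mean `μ`, let `G_n` (probabilities `gN n k`) be its truncation to `{0, …, n-1}` with
mean `μN n`. Then for `t ∈ [0,1]`,
`(1 + μN n (t-1)/(n-1))^{n-1} · E[((n-1)/(n-1+μN n (t-1)))^{Y_n}] → e^{μ(t-1)}`,
where `Y_n ~ G_n`; i.e. the number `Z_k` of incoming edges at a fixed vertex from
vertices not hit by its outgoing edges in the directed random graph converges in
distribution to a Poisson law with mean `μ`. -/
theorem dgrd_incoming_pgf_tendsto_poisson
    (g : ℕ → ℝ) (hg : ∀ k, 0 ≤ g k) (hsum : (∑' k, g k) = 1)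
    (hmean : Summable (fun k : ℕ => (k : ℝ) * g k)) (μ : ℝ) (hμ : μ = ∑' k : ℕ, (k : ℝ) * g k)
    (gN : ℕ → ℕ → ℝ)
    (hgN : ∀ n k, gN n k =
      if k < n - 1 then g k
      else if k = n - 1 then ∑' j : ℕ, (if n - 1 ≤ j then g j else 0)
      else 0)
    (μN : ℕ → ℝ) (hμN : ∀ n, μN n = ∑ k ∈ Finset.range n, (k : ℝ) * gN n k)
    (t : ℝ) (ht : t ∈ Set.Icc (0:ℝ) 1) :
    Tendsto (fun n : ℕ =>
        (1 + μN n * (t - 1) / ((n : ℝ) - 1)) ^ (n - 1) *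
        ∑ k ∈ Finset.range n, gN n k *
          (((n : ℝ) - 1) / ((n : ℝ) - 1 + μN n * (t - 1))) ^ k)
      atTop (nhds (Real.exp (μ * (t - 1)))) := by
  have hsg : Summable g := by
    by_contra h
    rw [tsum_eq_zero_of_not_summable h] at hsum
    exact zero_ne_one hsum
  have hsgi : ∀ N : ℕ, Summable (fun j : ℕ => if N ≤ j then g j else 0) := fun N =>
    (hsg.indicator {j : ℕ | N ≤ j}).congr fun j => by simp [Set.indicator]
  have hsmi : ∀ N : ℕ, Summable (fun j : ℕ => if N ≤ j then (j:ℝ) * g j else 0) := fun N =>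
    (hmean.indicator {j : ℕ | N ≤ j}).congr fun j => by simp [Set.indicator]
  have hT0 : ∀ N : ℕ, 0 ≤ ∑' j : ℕ, (if N ≤ j then g j else 0) := fun N =>
    tsum_nonneg fun j => by split_ifs <;> simp [hg]
  have hp0 : ∀ n k, 0 ≤ gN n k := by
    intro n k
    rw [hgN]
    split_ifs
    · exact hg k
    · exact hT0 _
    · exact le_rfl
  have hlt : ∀ N, ∀ k ∈ Finset.range N, gN (N+1) k = g k := by
    intro N k hk
    rw [hgN, if_pos (by simpa using hk)]
  have heq : ∀ N, gN (N+1) N = ∑' j : ℕ, (if N ≤ j then g j else 0) := by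
    intro N
    rw [hgN]
    simp
  have hp1 : ∀ N, ∑ k ∈ Finset.range (N+1), gN (N+1) k = 1 := by
    intro N
    rw [Finset.sum_range_succ, heq, Finset.sum_congr rfl (hlt N), aux_split g hsg, hsum]
  have hm : ∀ N, μN (N+1) = ∑ k ∈ Finset.range N, (k:ℝ) * g k
      + N * ∑' j : ℕ, (if N ≤ j then g j else 0) := by
    intro N
    rw [hμN, Finset.sum_range_succ, heq]
    congr 1
    exact Finset.sum_congr rfl fun k hk => by rw [hlt N k hk]
  have hmlo : ∀ N, ∑ k ∈ Finset.range N, (k:ℝ) * g k ≤ μN (N+1) := by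
    intro N
    rw [hm]
    have := mul_nonneg (Nat.cast_nonneg (α := ℝ) N) (hT0 N)
    linarith
  have hmhi : ∀ N, μN (N+1) ≤ μ := by
    intro N
    rw [hm, hμ, ← aux_split _ hmean N, ← tsum_mul_left]
    have : ∑' j : ℕ, (N:ℝ) * (if N ≤ j then g j else 0)
        ≤ ∑' j : ℕ, (if N ≤ j then (j:ℝ) * g j else 0) := by
      refine Summable.tsum_le_tsum (fun j => ?_) ((hsgi N).mul_left _) (hsmi N)
      split_ifs with h
      · exact mul_le_mul_of_nonneg_right (by exact_mod_cast h) (hg j)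
      · simp
    linarith
  have hm0 : ∀ N, 0 ≤ μN (N+1) := fun N =>
    (Finset.sum_nonneg fun k _ => mul_nonneg (Nat.cast_nonneg _) (hg k)).trans (hmlo N)
  have hmt : Tendsto (fun N => μN (N+1)) atTop (nhds μ) := by
    refine tendsto_of_tendsto_of_tendsto_of_le_of_le ?_ tendsto_const_nhds hmlo hmhi
    rw [hμ]
    exact hmean.hasSum.tendsto_sum_nat
  obtain ⟨ht0, ht1⟩ := ht
  have hdiv : Tendsto (fun N : ℕ => μN (N+1) * (t-1) / (N:ℝ)) atTop (nhds 0) :=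
    (hmt.mul_const (t-1)).div_atTop tendsto_natCast_atTop_atTop
  have hpow : Tendsto (fun N : ℕ => (1 + μN (N+1) * (t-1) / (N:ℝ)) ^ N) atTop
      (nhds (Real.exp (μ * (t-1)))) := by
    apply Real.tendsto_one_add_pow_exp_of_tendsto
    refine (hmt.mul_const (t-1)).congr' ?_
    filter_upwards [eventually_gt_atTop 0] with N hN
    have : (N:ℝ) ≠ 0 := by positivity
    field_simp
  have hup : Tendsto (fun N : ℕ => (1 + μN (N+1) * (t-1) / (N:ℝ)) ^ N
      + μN (N+1) * (1 - (1 + μN (N+1) * (t-1) / (N:ℝ)))) atTop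
      (nhds (Real.exp (μ * (t-1)))) := by
    have := hpow.add (hmt.mul ((hdiv.const_add 1).const_sub 1))
    simpa using this
  rw [← tendsto_add_atTop_iff_nat 1]
  have hev : ∀ᶠ N : ℕ in atTop, 0 < N ∧ 0 < 1 + μN (N+1) * (t-1) / (N:ℝ) := by
    refine (eventually_gt_atTop 0).and ?_
    have := hdiv.const_add 1
    rw [add_zero] at this
    exact this.eventually (lt_mem_nhds zero_lt_one)
  have hall : ∀ᶠ N : ℕ in atTop, 0 < N ∧ 0 < 1 + μN (N+1) * (t-1) / (N:ℝ) ∧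
      (((N + 1 : ℕ) : ℝ) - 1) = N ∧
      (N:ℝ) / (N + μN (N+1) * (t - 1)) = (1 + μN (N+1) * (t-1) / (N:ℝ))⁻¹ ∧
      1 + μN (N+1) * (t-1) / (N:ℝ) ≤ 1 := by
    filter_upwards [hev] with N hN
    obtain ⟨hN0, hA⟩ := hN
    have hNp : (0:ℝ) < N := by exact_mod_cast hN0
    refine ⟨hN0, hA, by push_cast; ring, ?_, ?_⟩
    · rw [show 1 + μN (N+1) * (t-1) / (N:ℝ) = (N + μN (N+1) * (t - 1)) / N by
        field_simp, inv_div]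
    · have : μN (N+1) * (t-1) / (N:ℝ) ≤ 0 :=
        div_nonpos_of_nonpos_of_nonneg
          (mul_nonpos_of_nonneg_of_nonpos (hm0 N) (by linarith)) hNp.le
      linarith
  refine tendsto_of_tendsto_of_tendsto_of_le_of_le' hpow hup ?_ ?_
  · filter_upwards [hall] with N hN
    obtain ⟨_, hA, hc, hi, hA1⟩ := hN
    rw [hc, hi, Nat.add_sub_cancel]
    exact (aux_bound (gN (N+1)) (hp0 _) N _ hA hA1 (hp1 N)).1
  · filter_upwards [hall] with N hN
    obtain ⟨_, hA, hc, hi, hA1⟩ := hN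
    rw [hc, hi, Nat.add_sub_cancel]
    have := (aux_bound (gN (N+1)) (hp0 _) N _ hA hA1 (hp1 N)).2
    rwa [← hμN (N+1)] at this
end

section
/- For every t ∈ [0,1], lim_{n→∞} (1 + μ_n (t−1)/(n−1))^{n−1} · E[ ( t(n−1)/(n − 1 + μ_n (t−1)) )^{Y_n} ] = ψ_G(t) · e^{μ(t−1)}, where ψ_G(t) = Σ_{k≥0} g_k t^k is the probability generating function of G. (The left-hand side equals the probability generating function E[t^{Y_k + Z_k}] of the degree of a fixed vertex in the undirected graph G(n,G) obtained from the directed random graph by removing directions and fusing multiple edges; hence the degree converges in distribution to the convolution G * Po(μ) of G with a Poisson distribution of mean μ.) -/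
open Filter Finset

/-- Let `G = {g k}` be a probability distribution on ℕ with finite
mean `μ`, let `G_n` (probabilities `gN n k`) be its truncation to `{0, …, n-1}` with
mean `μN n`. Then for `t ∈ [0,1]`,
`(1 + μN n (t-1)/(n-1))^{n-1} · E[(t(n-1)/(n-1+μN n (t-1)))^{Y_n}] → ψ_G(t) e^{μ(t-1)}`,
where `Y_n ~ G_n` and `ψ_G(t) = ∑ g_k t^k`; i.e. the degree of a fixed vertex of the
undirected graph obtained from the directed random graph by removing directions and
fusing multiple edges converges in distribution to `G * Po(μ)`. -/
theorem dgrd_degree_pgf_tendsto_convolution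
    (g : ℕ → ℝ) (hg : ∀ k, 0 ≤ g k) (hsum : (∑' k, g k) = 1)
    (hmean : Summable (fun k : ℕ => (k : ℝ) * g k)) (μ : ℝ)
    (hμ : μ = ∑' k : ℕ, (k : ℝ) * g k)
    (gN : ℕ → ℕ → ℝ)
    (hgN : ∀ n k, gN n k =
      if k < n - 1 then g k
      else if k = n - 1 then ∑' j : ℕ, (if n - 1 ≤ j then g j else 0)
      else 0)
    (μN : ℕ → ℝ) (hμN : ∀ n, μN n = ∑ k ∈ Finset.range n, (k : ℝ) * gN n k)
    (t : ℝ) (ht : t ∈ Set.Icc (0:ℝ) 1) :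
    Tendsto (fun n : ℕ =>
        (1 + μN n * (t - 1) / ((n : ℝ) - 1)) ^ (n - 1) *
        ∑ k ∈ Finset.range n, gN n k *
          ((t * ((n : ℝ) - 1)) / ((n : ℝ) - 1 + μN n * (t - 1))) ^ k)
      atTop (nhds ((∑' k : ℕ, g k * t ^ k) * Real.exp (μ * (t - 1)))) := by
  have hs : Summable g := by
    by_contra h
    rw [tsum_eq_zero_of_not_summable h] at hsum
    norm_num at hsum
  obtain ⟨ht0, ht1⟩ := ht
  have htail : ∀ m : ℕ, Summable (fun j : ℕ => if m ≤ j then g j else 0) := fun m =>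
    Summable.of_nonneg_of_le (fun j => by split_ifs <;> simp [hg]) (fun j => by
      split_ifs <;> simp [hg]) hs
  have htail2 : ∀ m : ℕ, Summable (fun j : ℕ => if m ≤ j then (j:ℝ) * g j else 0) := fun m =>
    Summable.of_nonneg_of_le
      (fun j => by have := mul_nonneg (Nat.cast_nonneg (α := ℝ) j) (hg j); split_ifs <;> simp [this])
      (fun j => by
        have := mul_nonneg (Nat.cast_nonneg (α := ℝ) j) (hg j); split_ifs <;> simp [this]) hmean
  set T : ℕ → ℝ := fun m => ∑' j : ℕ, (if m ≤ j then g j else 0) with hT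
  have hT0 : ∀ m, 0 ≤ T m := fun m => tsum_nonneg (fun j => by split_ifs <;> simp [hg])
  have hS : Tendsto (fun m : ℕ => ∑' j : ℕ, (if m ≤ j then (j:ℝ) * g j else 0)) atTop (nhds 0) := by
    have := tendsto_tsum_of_dominated_convergence (𝓕 := (atTop : Filter ℕ))
      (f := fun m j : ℕ => (if m ≤ j then (j:ℝ) * g j else 0)) (g := fun _ => (0:ℝ)) hmean
      (fun k => by
        refine tendsto_const_nhds.congr' ?_
        filter_upwards [eventually_gt_atTop k] with m hm
        rw [if_neg (by omega)])
      (Eventually.of_forall fun m k => by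
        have := mul_nonneg (Nat.cast_nonneg (α := ℝ) k) (hg k)
        rw [Real.norm_eq_abs]
        split_ifs
        · rw [abs_of_nonneg this]
        · simpa using this)
    simpa using this
  have hmT : Tendsto (fun m : ℕ => (m:ℝ) * T m) atTop (nhds 0) := by
    refine squeeze_zero (fun m => mul_nonneg (Nat.cast_nonneg m) (hT0 m)) (fun m => ?_) hS
    rw [hT, ← tsum_mul_left]
    refine Summable.tsum_le_tsum (fun j => ?_) ((htail m).mul_left _) (htail2 m)
    split_ifs with h
    · exact mul_le_mul_of_nonneg_right (by exact_mod_cast h) (hg j)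
    · simp
  have hTt : Tendsto T atTop (nhds 0) := by
    refine squeeze_zero' (Eventually.of_forall hT0) ?_ hmT
    filter_upwards [eventually_ge_atTop 1] with m hm
    have h1 : (1:ℝ) ≤ m := by exact_mod_cast hm
    nlinarith [hT0 m]
  have hsumN : ∀ (m : ℕ) (f : ℕ → ℝ), ∑ k ∈ Finset.range (m+1), gN (m+1) k * f k
      = ∑ k ∈ Finset.range m, g k * f k + T m * f m := by
    intro m f
    rw [Finset.sum_range_succ]
    congr 1
    · refine Finset.sum_congr rfl (fun k hk => ?_)
      rw [hgN, if_pos (by simpa using hk)]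
    · rw [hgN]; simp [hT]
  have hM : Tendsto (fun m : ℕ => μN (m+1)) atTop (nhds μ) := by
    have h1 : Tendsto (fun m : ℕ => ∑ k ∈ Finset.range m, (k:ℝ) * g k) atTop (nhds μ) := by
      rw [hμ]; exact hmean.hasSum.tendsto_sum_nat
    have h2 := h1.add hmT
    rw [add_zero] at h2
    refine h2.congr (fun m => ?_)
    rw [hμN]
    have := hsumN m (fun k => (k:ℝ))
    simp only [mul_comm] at this ⊢
    exact this.symm
  have hx : Tendsto (fun m : ℕ => μN (m+1) * (t-1)) atTop (nhds (μ * (t-1))) := hM.mul_const _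
  have hxm : Tendsto (fun m : ℕ => μN (m+1) * (t-1) / (m:ℝ)) atTop (nhds 0) :=
    hx.div_atTop tendsto_natCast_atTop_atTop
  have hexp : Tendsto (fun m : ℕ => (1 + μN (m+1) * (t-1) / (m:ℝ)) ^ m) atTop
      (nhds (Real.exp (μ * (t-1)))) := by
    refine Real.tendsto_one_add_pow_exp_of_tendsto ?_
    refine hx.congr' ?_
    filter_upwards [eventually_ge_atTop 1] with m hm
    have h1 : (m:ℝ) ≠ 0 := by positivity
    field_simp
  set r : ℕ → ℝ := fun m => t * (m:ℝ) / ((m:ℝ) + μN (m+1) * (t-1)) with hr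
  have hrt : Tendsto r atTop (nhds t) := by
    have h1 : Tendsto (fun m : ℕ => t / (1 + μN (m+1) * (t-1) / (m:ℝ))) atTop (nhds (t / (1+0))) :=
      tendsto_const_nhds.div (tendsto_const_nhds.add hxm) (by norm_num)
    rw [add_zero, div_one] at h1
    refine h1.congr' ?_
    filter_upwards [eventually_ge_atTop 1] with m hm
    have h1 : (m:ℝ) ≠ 0 := by positivity
    rw [hr]
    simp only
    rw [← mul_div_mul_right t _ h1]
    congr 1
    field_simp
  have hr01 : ∀ᶠ m in atTop, 0 ≤ r m ∧ r m ≤ 1 := by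
    filter_upwards [hM.eventually_lt_const (lt_add_one μ),
      hx.eventually_const_lt (sub_one_lt (μ * (t-1))),
      (tendsto_natCast_atTop_atTop (R := ℝ)).eventually_ge_atTop (μ+1),
      (tendsto_natCast_atTop_atTop (R := ℝ)).eventually_ge_atTop (-(μ*(t-1)-1))] with m h1 h2 h3 h4
    have hd : 0 < (m:ℝ) + μN (m+1) * (t-1) := by linarith
    refine ⟨div_nonneg (mul_nonneg ht0 (Nat.cast_nonneg m)) hd.le, (div_le_one hd).2 ?_⟩
    nlinarith
  have hmain : Tendsto (fun m : ℕ => ∑ k ∈ Finset.range m, g k * r m ^ k) atTop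
      (nhds (∑' k : ℕ, g k * t ^ k)) := by
    have := tendsto_tsum_of_dominated_convergence (𝓕 := (atTop : Filter ℕ))
      (f := fun m k : ℕ => (if k ∈ Finset.range m then g k * r m ^ k else 0))
      (g := fun k => g k * t ^ k) hs
      (fun k => by
        refine ((hrt.pow k).const_mul (g k)).congr' ?_
        filter_upwards [eventually_gt_atTop k] with m hm
        rw [if_pos (by simpa using hm)])
      (by
        filter_upwards [hr01] with m hm k
        rw [Real.norm_eq_abs]
        split_ifs
        · rw [abs_of_nonneg (mul_nonneg (hg k) (pow_nonneg hm.1 k))]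
          exact mul_le_of_le_one_right (hg k) (pow_le_one₀ hm.1 hm.2)
        · simpa using hg k)
    refine this.congr (fun m => ?_)
    rw [tsum_eq_sum (s := Finset.range m) (fun k hk => if_neg hk)]
    exact Finset.sum_congr rfl (fun k hk => if_pos hk)
  have hlast : Tendsto (fun m : ℕ => T m * r m ^ m) atTop (nhds 0) := by
    refine squeeze_zero' ?_ ?_ hTt
    · filter_upwards [hr01] with m hm
      exact mul_nonneg (hT0 m) (pow_nonneg hm.1 m)
    · filter_upwards [hr01] with m hm
      exact mul_le_of_le_one_right (hT0 m) (pow_le_one₀ hm.1 hm.2)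
  rw [← tendsto_add_atTop_iff_nat 1]
  have hfin := hexp.mul (hmain.add hlast)
  rw [add_zero, mul_comm (Real.exp _)] at hfin
  refine hfin.congr (fun m => ?_)
  rw [hsumN m (fun k => ((t * (((m+1 : ℕ) : ℝ) - 1)) / (((m+1 : ℕ) : ℝ) - 1 + μN (m+1) * (t - 1))) ^ k)]
  have hc : ((m+1 : ℕ) : ℝ) - 1 = m := by push_cast; ring
  simp only [hc, Nat.add_sub_cancel, hr]
end
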